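/- Define I₂ : ℝ⁵ → ℝ by I₂(x₁,x₂,x₃,x₄,x₅) = −2x₁²x₃/√3 + 2x₁x₂x₄ + x₂²x₃/√3 − x₂²x₅ + 2x₃³/(3√3) + x₃x₄²/√3 − 2x₃x₅²/√3 + x₄²x₅. Then for every x ∈ ℝ⁵ with x₁²+x₂²+x₃²+x₄²+x₅² = 1, I₂(x) ≤ 2/(3√3), and this maximum is attained at a point of the two-dimensional subspace S = {(0,0,a,0,b) : a,b ∈ ℝ}; in particular the maximum of I₂ over the unit sphere of ℝ⁵ equals its maximum over the unit sphere intersected with S, namely 2/(3√3). -/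

import Mathlib

noncomputable section

/-- The cubic fundamental invariant of the irreducible action of SO(3) on ℝ⁵, written
in the basis of real spherical harmonics of degree 2. -/
def I2 (x1 x2 x3 x4 x5 : ℝ) : ℝ :=
  -2 * x1 ^ 2 * x3 / Real.sqrt 3 + 2 * x1 * x2 * x4 + x2 ^ 2 * x3 / Real.sqrt 3 -
    x2 ^ 2 * x5 + 2 * x3 ^ 3 / (3 * Real.sqrt 3) + x3 * x4 ^ 2 / Real.sqrt 3 -
    2 * x3 * x5 ^ 2 / Real.sqrt 3 + x4 ^ 2 * x5

/-- For the traceless symmetric matrix `Q = !![p - u, a, b; a, -p - u, d; b, d, 2 * u]` with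
`tr (Q ^ 2) = 2`, expanding `0 ≤ tr ((Q ^ 2 - c • Q - 2 / 3) ^ 2)` bounds `det Q`. -/
theorem traceless_symm_det_bound (a b d p u c : ℝ)
    (h : a ^ 2 + b ^ 2 + d ^ 2 + p ^ 2 + 3 * u ^ 2 = 1) :
    6 * c * (2 * u ^ 3 - 2 * u * (p ^ 2 + a ^ 2) + u * (b ^ 2 + d ^ 2) + p * (b ^ 2 - d ^ 2) +
      2 * a * b * d) ≤ 2 / 3 + 2 * c ^ 2 := by
  have key : 0 ≤ ((p - u) ^ 2 + a ^ 2 + b ^ 2 - c * (p - u) - 2 / 3) ^ 2 +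
      (a ^ 2 + (p + u) ^ 2 + d ^ 2 + c * (p + u) - 2 / 3) ^ 2 +
      (b ^ 2 + d ^ 2 + 4 * u ^ 2 - 2 * c * u - 2 / 3) ^ 2 +
      2 * (-2 * a * u + b * d - c * a) ^ 2 + 2 * (b * (p + u) + a * d - c * b) ^ 2 +
      2 * (a * b + d * (u - p) - c * d) ^ 2 := by positivity
  linear_combination key + (2 * (a ^ 2 + b ^ 2 + d ^ 2 + p ^ 2 + 3 * u ^ 2) - 2 / 3 + 2 * c ^ 2) * h

/-- On the unit sphere of ℝ⁵ the invariant `I₂` is bounded by `2/(3√3)`, and this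
maximum is attained at a point of the two-dimensional subspace
`S = {(0,0,a,0,b) : a,b ∈ ℝ}`; in particular the maximum of `I₂` over the unit sphere
equals its maximum over the unit sphere intersected with `S`, namely `2/(3√3)`. -/
theorem I2_max_on_sphere :
    (∀ x1 x2 x3 x4 x5 : ℝ, x1 ^ 2 + x2 ^ 2 + x3 ^ 2 + x4 ^ 2 + x5 ^ 2 = 1 →
      I2 x1 x2 x3 x4 x5 ≤ 2 / (3 * Real.sqrt 3)) ∧
    (∃ a b : ℝ, 0 ^ 2 + 0 ^ 2 + a ^ 2 + 0 ^ 2 + b ^ 2 = 1 ∧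
      I2 0 0 a 0 b = 2 / (3 * Real.sqrt 3)) := by
  have hsq : Real.sqrt 3 ^ 2 = 3 := Real.sq_sqrt (by norm_num)
  constructor
  · intro x1 x2 x3 x4 x5 h
    obtain ⟨u, rfl⟩ : ∃ u, x3 = Real.sqrt 3 * u := ⟨x3 / Real.sqrt 3, by field_simp⟩
    have hdet : I2 x1 x2 (Real.sqrt 3 * u) x4 x5 = 2 * u ^ 3 - 2 * u * (x5 ^ 2 + x1 ^ 2) +
        u * (x4 ^ 2 + x2 ^ 2) + x5 * (x4 ^ 2 - x2 ^ 2) + 2 * x1 * x4 * x2 := by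
      unfold I2
      field_simp
      linear_combination 2 * u ^ 3 * hsq
    have hb := traceless_symm_det_bound x1 x4 x2 x5 u (Real.sqrt 3 / 3)
      (by linear_combination h - u ^ 2 * hsq)
    rw [← hdet] at hb
    rw [le_div_iff₀ (by positivity)]
    linear_combination 3 / 2 * hb + hsq / 3
  · exact ⟨1, 0, by norm_num, by simp [I2]⟩
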